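/- Littlewood–Richardson four-fold identity (Proposition 3.8). For any partitions λ, μ, ν, ω, Σ_{γ,η,σ,τ} (−1)^{|τ|} c^γ_{τ'ν} c^λ_{γη} c^σ_{ημ} c^ω_{στ} = δ_{λν} δ_{μω}, where the sum runs over all quadruples of partitions γ, η, σ, τ (only finitely many terms are nonzero, since the summand vanishes unless |γ| = |τ| + |ν|, |λ| = |γ| + |η|, |σ| = |η| + |μ| and |ω| = |σ| + |τ|), τ' denotes the conjugate of τ, and c^λ_{μν} are the Littlewood–Richardson coefficients. -/

import Mathlib

open scoped Classical

noncomputable section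

namespace DoubleMacdonald

/-- A partition, encoded as a weakly decreasing function `ℕ → ℕ` (0-indexed: `f 0 = λ₁`)
with finitely many nonzero values. -/
def IsPartition (f : ℕ → ℕ) : Prop :=
  (∀ ⦃i j : ℕ⦄, i ≤ j → f j ≤ f i) ∧ ∃ N, ∀ i, N ≤ i → f i = 0

/-- The type of partitions. -/
abbrev Partition : Type := {f : ℕ → ℕ // IsPartition f}

/-- The size `|λ| = Σᵢ λᵢ` of a partition. -/
def psize (f : ℕ → ℕ) : ℕ := ∑ᶠ i, f i

/-- The number `ℓ(λ)` of nonzero parts of a partition. -/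
def plen (f : ℕ → ℕ) : ℕ := Nat.card {i : ℕ | 1 ≤ f i}

/-- The conjugate partition: `λ'ⱼ = #{i : λᵢ ≥ j}` (0-indexed: `conj f j = λ'_{j+1}`). -/
def conj (f : ℕ → ℕ) : ℕ → ℕ := fun j => Nat.card {i : ℕ | j + 1 ≤ f i}

/-- The complete homogeneous symmetric polynomial `h_k` in `N` variables:
the sum of all monomials of degree `k` (with `h_0 = 1`). -/
def hPoly (N k : ℕ) : MvPolynomial (Fin N) ℤ :=
  ∑ m ∈ Finset.univ.filter (fun m : Fin N → Fin (k + 1) => ∑ i, (m i : ℕ) = k),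
    ∏ i, MvPolynomial.X i ^ ((m i : ℕ))

/-- `h_k` for an integer index: `h_k = 0` for `k < 0`. -/
def hZ (N : ℕ) (k : ℤ) : MvPolynomial (Fin N) ℤ := if k < 0 then 0 else hPoly N k.toNat

/-- The Schur polynomial `s_λ` in `N` variables, via the Jacobi–Trudi formula
`s_λ = det(h_{λᵢ − i + j})_{1 ≤ i,j ≤ ℓ(λ)}`. -/
def schur (N : ℕ) (f : ℕ → ℕ) : MvPolynomial (Fin N) ℤ :=
  (Matrix.of fun i j : Fin (plen f) =>
    hZ N ((f (i : ℕ) : ℤ) + ((j : ℕ) : ℤ) - ((i : ℕ) : ℤ))).det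


/-! ### Basic facts on partitions -/

lemma conj_spec {f : ℕ → ℕ} (hf : IsPartition f) (i j : ℕ) : j < f i ↔ i < conj f j := by
  obtain ⟨h1, M, hM⟩ := hf
  have hex : ∃ n, ¬ (j + 1 ≤ f n) := ⟨M, by rw [hM M le_rfl]; omega⟩
  have key : ∀ k, j + 1 ≤ f k ↔ k < Nat.find hex := by
    intro k
    constructor
    · intro hk
      by_contra hcon
      exact Nat.find_spec hex (hk.trans (h1 (not_lt.1 hcon)))
    · intro hk
      have := Nat.find_min hex hk
      simpa using this
  have hs : {i : ℕ | j + 1 ≤ f i} = Set.Iio (Nat.find hex) := by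
    ext k; exact key k
  have : conj f j = Nat.find hex := by
    unfold conj
    rw [hs]
    simp
  rw [this, ← key]
  rfl

lemma plen_spec {f : ℕ → ℕ} (hf : IsPartition f) (i : ℕ) : 0 < f i ↔ i < plen f :=
  conj_spec hf i 0

lemma psize_eq_sum {f : ℕ → ℕ} {n : ℕ} (h : ∀ i, n ≤ i → f i = 0) :
    psize f = ∑ i : Fin n, f i := by
  unfold psize
  rw [Fin.sum_univ_eq_sum_range]
  apply finsum_eq_sum_of_support_subset
  intro i hi
  simp only [Function.mem_support] at hi
  simp only [Finset.coe_range, Set.mem_Iio]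
  by_contra hcon
  exact hi (h i (by omega))

lemma conj_isPartition {f : ℕ → ℕ} (hf : IsPartition f) : IsPartition (conj f) := by
  refine ⟨?_, f 0, ?_⟩
  · intro i j hij
    by_contra hcon
    push Not at hcon
    have := (conj_spec hf (conj f i) j).2 hcon
    have h2 := (conj_spec hf (conj f i) i).1 (by omega)
    omega
  · intro i hi
    by_contra hcon
    have := (conj_spec hf 0 i).2 (by omega)
    omega

lemma psize_conj {f : ℕ → ℕ} (hf : IsPartition f) : psize (conj f) = psize f := by
  have h1 : ∀ i, plen f ≤ i → f i = 0 := fun i hi => by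
    by_contra hcon
    have := (plen_spec hf i).1 (by omega)
    omega
  have h2 : ∀ j, f 0 ≤ j → conj f j = 0 := fun j hj => by
    by_contra hcon
    have := (conj_spec hf 0 j).2 (by omega)
    omega
  rw [psize_eq_sum h1, psize_eq_sum h2, Fin.sum_univ_eq_sum_range, Fin.sum_univ_eq_sum_range]
  have e1 : ∀ j ∈ Finset.range (f 0), conj f j
      = ∑ i ∈ Finset.range (plen f), if j < f i then 1 else 0 := by
    intro j hj
    rw [Finset.sum_boole]
    have : (Finset.range (plen f)).filter (fun i => j < f i) = Finset.range (conj f j) := by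
      ext i
      simp only [Finset.mem_filter, Finset.mem_range, ← conj_spec hf, ← plen_spec hf]
      omega
    rw [this]; simp
  have e2 : ∀ i ∈ Finset.range (plen f), f i
      = ∑ j ∈ Finset.range (f 0), if j < f i then 1 else 0 := by
    intro i hi
    rw [Finset.sum_boole]
    have : (Finset.range (f 0)).filter (fun j => j < f i) = Finset.range (f i) := by
      ext j
      have := hf.1 (Nat.zero_le i)
      simp only [Finset.mem_filter, Finset.mem_range]
      omega
    rw [this]; simp
  rw [Finset.sum_congr rfl e1, Finset.sum_congr rfl e2, Finset.sum_comm]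

lemma eq_zero_of_size_le {f : ℕ → ℕ} (hf : IsPartition f) {n : ℕ} (hn : psize f ≤ n)
    (i : ℕ) (hi : n ≤ i) : f i = 0 := by
  by_contra hcon
  have h1 : ∀ i, plen f ≤ i → f i = 0 := fun i hi => by
    by_contra hcon
    have := (plen_spec hf i).1 (by omega)
    omega
  rw [psize_eq_sum h1] at hn
  have h2 : ∑ i : Fin (plen f), 1 ≤ ∑ i : Fin (plen f), f i :=
    Finset.sum_le_sum fun i _ => (plen_spec hf i).2 i.2
  have := (plen_spec hf i).1 (by omega)
  simp at h2
  omega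

lemma le_psize {f : ℕ → ℕ} (hf : IsPartition f) (i : ℕ) : f i ≤ psize f := by
  obtain ⟨M, hM⟩ := hf.2
  by_cases hi : i < M
  · rw [psize_eq_sum hM]
    exact Finset.single_le_sum (f := fun i : Fin M => f i) (fun _ _ => Nat.zero_le _)
      (Finset.mem_univ (⟨i, hi⟩ : Fin M))
  · rw [hM i (by omega)]; omega

lemma finite_parts (D : ℕ) : {p : Partition | psize p.1 ≤ D}.Finite := by
  have : Function.Injective (fun p : {p : Partition | psize p.1 ≤ D} =>
      (fun i : Fin D => (⟨p.1.1 i, Nat.lt_succ_of_le ((le_psize p.1.2 i).trans p.2)⟩ :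
        Fin (D + 1)))) := by
    intro p q hpq
    apply Subtype.ext
    apply Subtype.ext
    funext i
    by_cases hi : i < D
    · have := congrFun hpq ⟨i, hi⟩
      simpa using this
    · rw [eq_zero_of_size_le p.1.2 p.2 i (by omega), eq_zero_of_size_le q.1.2 q.2 i (by omega)]
  exact Set.finite_coe_iff.1 (Finite.of_injective _ this)

/-- The finite set of partitions of size at most `D`. -/
def parts (D : ℕ) : Finset Partition := (finite_parts D).toFinset

lemma mem_parts {D : ℕ} {p : Partition} : p ∈ parts D ↔ psize p.1 ≤ D := by
  simp [parts]

/-! ### Generic Jacobi-Trudi determinants -/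

section JTsec

variable {R : Type} [CommRing R]

/-- extension of a sequence by zero to negative indices -/
def aZ (a : ℕ → R) (k : ℤ) : R := if k < 0 then 0 else a k.toNat

lemma aZ_neg (a : ℕ → R) {k : ℤ} (h : k < 0) : aZ a k = 0 := if_pos h

lemma aZ_nat (a : ℕ → R) (k : ℕ) : aZ a (k : ℤ) = a k := by simp [aZ]

/-- Jacobi-Trudi determinant of size `n` for an arbitrary sequence. -/
def JT (a : ℕ → R) (n : ℕ) (f : ℕ → ℕ) : R :=
  (Matrix.of fun i j : Fin n => aZ a ((f (i : ℕ) : ℤ) + ((j : ℕ) : ℤ) - ((i : ℕ) : ℤ))).det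

lemma JT_succ (a : ℕ → R) (ha : a 0 = 1) (n : ℕ) (f : ℕ → ℕ) (hf : f n = 0) :
    JT a (n + 1) f = JT a n f := by
  unfold JT
  rw [Matrix.det_succ_row _ (Fin.last n), Finset.sum_eq_single (Fin.last n)]
  · have h1 : aZ a 0 = 1 := by rw [show (0 : ℤ) = ((0 : ℕ) : ℤ) from rfl, aZ_nat, ha]
    have h2 : ((-1 : R)) ^ (n + n) = 1 := by rw [← two_mul]; simp
    simp only [Fin.val_last, Matrix.of_apply, hf, h2, one_mul]
    simp only [Nat.cast_zero, zero_add, sub_self, h1, one_mul]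
    congr 1
    ext i j
    simp [Matrix.submatrix_apply]
  · intro j _ hj
    have : (j : ℕ) < n := by
      have := j.2
      have h3 : (j : ℕ) ≠ n := fun h => hj (Fin.ext h)
      omega
    simp only [Matrix.of_apply, Fin.val_last, hf]
    rw [aZ_neg]
    · simp
    · push_cast; omega
  · simp

lemma JT_add (a : ℕ → R) (ha : a 0 = 1) (n k : ℕ) (f : ℕ → ℕ) (hf : ∀ i, n ≤ i → f i = 0) :
    JT a (n + k) f = JT a n f := by
  induction k with
  | zero => rfl
  | succ k ih => rw [← add_assoc, JT_succ a ha _ _ (hf _ (by omega)), ih]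

lemma JT_stable (a : ℕ → R) (ha : a 0 = 1) (n m : ℕ) (f : ℕ → ℕ) (hf : ∀ i, n ≤ i → f i = 0)
    (hf' : ∀ i, m ≤ i → f i = 0) : JT a n f = JT a m f := by
  rcases le_total n m with h | h
  · obtain ⟨k, rfl⟩ := Nat.exists_eq_add_of_le h
    rw [JT_add a ha n k f hf]
  · obtain ⟨k, rfl⟩ := Nat.exists_eq_add_of_le h
    rw [JT_add a ha m k f hf']

end JTsec

lemma eq_zero_of_plen {f : ℕ → ℕ} (hf : IsPartition f) (i : ℕ) (hi : plen f ≤ i) : f i = 0 := by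
  by_contra hcon
  have := (plen_spec hf i).1 (by omega)
  omega

lemma hPoly_zero (N : ℕ) : hPoly N 0 = 1 := by
  unfold hPoly
  have : (Finset.univ.filter (fun m : Fin N → Fin (0 + 1) => ∑ i, (m i : ℕ) = 0)) = {0} := by
    ext m
    simp only [Finset.mem_filter, Finset.mem_univ, true_and, Finset.mem_singleton]
    constructor
    · intro _; funext i; apply Fin.ext; have := (m i).2; simp
    · rintro rfl; simp
  rw [this]; simp

lemma schur_eq_JT {N n : ℕ} {f : ℕ → ℕ} (hf : IsPartition f) (hn : ∀ i, n ≤ i → f i = 0) :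
    schur N f = JT (hPoly N) n f := by
  have : schur N f = JT (hPoly N) (plen f) f := rfl
  rw [this]
  exact JT_stable _ (hPoly_zero N) _ _ _ (eq_zero_of_plen hf) hn

lemma hPoly_homog (N k : ℕ) : (hPoly N k).IsHomogeneous k := by
  unfold hPoly
  apply MvPolynomial.IsHomogeneous.sum
  intro m hm
  simp only [Finset.mem_filter, Finset.mem_univ, true_and] at hm
  conv => arg 2; rw [← hm]
  exact MvPolynomial.IsHomogeneous.prod _ _ _ fun i _ => MvPolynomial.isHomogeneous_X_pow i _

lemma JT_homog (N n : ℕ) (f : ℕ → ℕ) :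
    (JT (hPoly N) n f).IsHomogeneous (∑ i : Fin n, f i) := by
  unfold JT
  rw [Matrix.det_apply]
  apply MvPolynomial.IsHomogeneous.sum
  intro σ _
  have key : (∏ i : Fin n, (Matrix.of fun i j : Fin n => aZ (hPoly N) ((f (i : ℕ) : ℤ) +
      ((j : ℕ) : ℤ) - ((i : ℕ) : ℤ))) (σ i) i).IsHomogeneous (∑ i : Fin n, f i) := by
    by_cases h : ∃ i : Fin n, (f (σ i : ℕ) : ℤ) + ((i : ℕ) : ℤ) - ((σ i : ℕ) : ℤ) < 0
    · obtain ⟨i, hi⟩ := h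
      rw [Finset.prod_eq_zero (Finset.mem_univ i)]
      · exact MvPolynomial.isHomogeneous_zero _ _ _
      · rw [Matrix.of_apply, aZ_neg _ hi]
    · push Not at h
      have hs : ∑ i : Fin n, f i
          = ∑ i : Fin n, ((f (σ i : ℕ) : ℤ) + ((i : ℕ) : ℤ) - ((σ i : ℕ) : ℤ)).toNat := by
        zify
        rw [Finset.sum_congr rfl fun i _ => Int.toNat_of_nonneg (h i), Finset.sum_sub_distrib,
          Finset.sum_add_distrib, Equiv.sum_comp σ (fun i : Fin n => ((i : ℕ) : ℤ)),
          Equiv.sum_comp σ (fun i : Fin n => (f (i : ℕ) : ℤ))]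
        ring
      rw [hs]
      apply MvPolynomial.IsHomogeneous.prod
      intro i _
      rw [Matrix.of_apply, aZ, if_neg (not_lt.2 (h i))]
      exact hPoly_homog _ _
  rcases Int.units_eq_one_or (Equiv.Perm.sign σ) with h | h
  · rw [h, one_smul]; exact key
  · rw [h, Units.neg_smul, one_smul]; exact key.neg

lemma schur_homog {N : ℕ} {f : ℕ → ℕ} (hf : IsPartition f) :
    (schur N f).IsHomogeneous (psize f) := by
  rw [psize_eq_sum (eq_zero_of_plen hf)]
  exact JT_homog N (plen f) f

/-! ### Generating functions and the bialternant formula -/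

/-- The power series `Π_{i ∈ s} (1 - x_i t)`. -/
def eSer (N : ℕ) (s : Finset (Fin N)) : PowerSeries (MvPolynomial (Fin N) ℤ) :=
  ∏ i ∈ s, (1 - PowerSeries.C (MvPolynomial.X i) * PowerSeries.X)

lemma geom_mul (R : Type) [CommRing R] (x : R) :
    PowerSeries.mk (fun p => x ^ p) * (1 - PowerSeries.C x * PowerSeries.X) = 1 := by
  ext n
  rw [mul_sub, mul_one, ← mul_assoc, mul_comm _ (PowerSeries.C x), map_sub]
  cases n with
  | zero => simp
  | succ n =>
    rw [PowerSeries.coeff_succ_mul_X, PowerSeries.coeff_C_mul, PowerSeries.coeff_mk,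
      PowerSeries.coeff_mk, PowerSeries.coeff_one, if_neg (by omega)]
    ring

lemma hPoly_gen (N : ℕ) : PowerSeries.mk (hPoly N) =
    ∏ i : Fin N, PowerSeries.mk (fun p => (MvPolynomial.X i : MvPolynomial (Fin N) ℤ) ^ p) := by
  ext1 k
  rw [PowerSeries.coeff_mk, PowerSeries.coeff_prod]
  simp only [PowerSeries.coeff_mk]
  unfold hPoly
  refine Finset.sum_bij (fun m _ => Finsupp.equivFunOnFinite.symm fun i => (m i : ℕ)) ?_ ?_ ?_ ?_
  · intro m hm
    simp only [Finset.mem_filter, Finset.mem_univ, true_and] at hm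
    simp [Finset.mem_finsuppAntidiag, hm]
  · intro m _ m' _ h
    funext i
    apply Fin.ext
    have := DFunLike.congr_fun h i
    simpa using this
  · intro l hl
    simp only [Finset.mem_finsuppAntidiag] at hl
    refine ⟨fun i => ⟨l i, ?_⟩, ?_, ?_⟩
    · have := Finset.single_le_sum (f := fun i => l i) (fun _ _ => Nat.zero_le _)
        (Finset.mem_univ i)
      have h2 : ∑ x, l x = k := hl.1
      omega
    · simp [hl.1]
    · ext i; simp
  · intro m _
    simp

lemma hPoly_mul_eSer (N : ℕ) : PowerSeries.mk (hPoly N) * eSer N Finset.univ = 1 := by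
  rw [hPoly_gen, eSer, ← Finset.prod_mul_distrib]
  exact Finset.prod_eq_one fun i _ => geom_mul _ _

lemma hPoly_mul_eSer_erase (N : ℕ) (k : Fin N) :
    PowerSeries.mk (hPoly N) * eSer N (Finset.univ.erase k)
      = PowerSeries.mk (fun p => (MvPolynomial.X k : MvPolynomial (Fin N) ℤ) ^ p) := by
  have h := hPoly_mul_eSer N
  rw [eSer, ← Finset.mul_prod_erase _ _ (Finset.mem_univ k)] at h
  have h2 := geom_mul _ (MvPolynomial.X k : MvPolynomial (Fin N) ℤ)
  unfold eSer
  linear_combination (PowerSeries.mk (fun p => (MvPolynomial.X k : MvPolynomial (Fin N) ℤ) ^ p)) * h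
    - (PowerSeries.mk (hPoly N) * ∏ i ∈ Finset.univ.erase k,
      (1 - PowerSeries.C (MvPolynomial.X i) * PowerSeries.X)) * h2

lemma eSer_coeff_zero (N : ℕ) (s : Finset (Fin N)) (r : ℕ) (hr : s.card < r) :
    PowerSeries.coeff r (eSer N s) = 0 := by
  induction s using Finset.induction_on generalizing r with
  | empty => simp [eSer, PowerSeries.coeff_one]; intro h; simp at hr; omega
  | insert i s hi ih =>
    rw [Finset.card_insert_of_notMem hi] at hr
    have : eSer N (insert i s) = eSer N s
        - PowerSeries.C (MvPolynomial.X i) * (eSer N s * PowerSeries.X) := by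
      unfold eSer
      rw [Finset.prod_insert hi]; ring
    obtain ⟨r, rfl⟩ : ∃ r', r = r' + 1 := ⟨r - 1, by omega⟩
    rw [this, map_sub, PowerSeries.coeff_C_mul, PowerSeries.coeff_succ_mul_X,
      ih _ (by omega), ih _ (by omega)]
    simp

/-- alternant -/
def alt (N : ℕ) (g : Fin N → ℕ) : MvPolynomial (Fin N) ℤ :=
  (Matrix.of fun i k : Fin N => (MvPolynomial.X k : MvPolynomial (Fin N) ℤ) ^ g i).det

/-- staircase shift of a partition -/
def sh (N : ℕ) (f : ℕ → ℕ) (i : Fin N) : ℕ := f i + (i.rev : ℕ)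

lemma pow_expand (N : ℕ) (k : Fin N) (p : ℕ) :
    (MvPolynomial.X k : MvPolynomial (Fin N) ℤ) ^ p =
      ∑ j : Fin N, aZ (hPoly N) ((p : ℤ) - (j.rev : ℕ)) *
        PowerSeries.coeff (j.rev : ℕ) (eSer N (Finset.univ.erase k)) := by
  have h := congrArg (PowerSeries.coeff p) (hPoly_mul_eSer_erase N k)
  rw [PowerSeries.coeff_mk, mul_comm, PowerSeries.coeff_mul,
    Finset.Nat.sum_antidiagonal_eq_sum_range_succ_mk] at h
  rw [← h]
  simp only [PowerSeries.coeff_mk]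
  have e0 := Equiv.sum_comp Fin.revPerm (fun j : Fin N => aZ (hPoly N) ((p : ℤ) - (j : ℕ)) *
        PowerSeries.coeff (j : ℕ) (eSer N (Finset.univ.erase k)))
  simp only [Fin.revPerm_apply] at e0
  rw [e0]
  rw [Fin.sum_univ_eq_sum_range (fun j => aZ (hPoly N) ((p : ℤ) - (j : ℕ)) *
        PowerSeries.coeff j (eSer N (Finset.univ.erase k)))]
  have e1 : ∀ r ∈ Finset.range (p + 1), PowerSeries.coeff r (eSer N (Finset.univ.erase k)) *
      hPoly N (p - r) = aZ (hPoly N) ((p : ℤ) - (r : ℕ)) *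
        PowerSeries.coeff r (eSer N (Finset.univ.erase k)) := by
    intro r hr
    rw [Finset.mem_range] at hr
    rw [show (p : ℤ) - (r : ℕ) = ((p - r : ℕ) : ℤ) by omega, aZ_nat, mul_comm]
  rw [Finset.sum_congr rfl e1]
  have hcard : (Finset.univ.erase k).card = N - 1 := by simp
  have hN := k.2
  rw [Finset.sum_subset (s₂ := Finset.range (N + p + 1)), eq_comm,
    Finset.sum_subset (s₂ := Finset.range (N + p + 1))]
  · intro r hr; simp only [Finset.mem_range] at *; omega
  · intro r _ hr
    rw [eSer_coeff_zero, mul_zero]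
    simp only [Finset.mem_range] at hr; omega
  · intro r hr; simp only [Finset.mem_range] at *; omega
  · intro r _ hr
    rw [aZ_neg, zero_mul]
    simp only [Finset.mem_range] at hr; omega

lemma alt_sh (N : ℕ) (f : ℕ → ℕ) : alt N (sh N f) = JT (hPoly N) N f *
    (Matrix.of fun j k : Fin N =>
      PowerSeries.coeff (j.rev : ℕ) (eSer N (Finset.univ.erase k))).det := by
  unfold alt JT
  rw [← Matrix.det_mul]
  congr 1
  ext1 i k
  rw [Matrix.mul_apply, Matrix.of_apply, pow_expand]
  refine Finset.sum_congr rfl fun j _ => ?_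
  rw [Matrix.of_apply, Matrix.of_apply]
  congr 2
  simp only [sh, Fin.val_rev]
  have := i.2; have := j.2
  omega

lemma bialternant (N : ℕ) (f : ℕ → ℕ) :
    alt N (sh N 0) * JT (hPoly N) N f = alt N (sh N f) := by
  have h0 : JT (hPoly N) N 0 = 1 := by
    rw [JT_stable _ (hPoly_zero N) N 0 0 (by simp) (by simp)]
    simp [JT]
  rw [alt_sh, alt_sh, h0]; ring

/-! ### Dual Jacobi-Trudi via complementary minors -/

lemma compl_minor {R : Type} [CommRing R] {n m : ℕ} (A B : Matrix (Fin n ⊕ Fin m) (Fin n ⊕ Fin m) R)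
    (h : A * B = 1) : A.toBlocks₁₁.det = A.det * B.toBlocks₂₂.det := by
  have h1 : A * Matrix.fromBlocks 1 B.toBlocks₁₂ 0 B.toBlocks₂₂
      = Matrix.fromBlocks A.toBlocks₁₁ 0 A.toBlocks₂₁ 1 := by
    rw [← Matrix.fromBlocks_toBlocks A, ← Matrix.fromBlocks_toBlocks B,
      Matrix.fromBlocks_multiply, ← Matrix.fromBlocks_one, Matrix.fromBlocks_inj] at h
    obtain ⟨-, h12, -, h22⟩ := h
    conv_lhs => rw [← Matrix.fromBlocks_toBlocks A]
    rw [Matrix.fromBlocks_multiply, h12, h22]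
    simp
  have h2 := congrArg Matrix.det h1
  rw [Matrix.det_mul, Matrix.det_fromBlocks_zero₂₁, Matrix.det_fromBlocks_zero₁₂] at h2
  simpa using h2.symm

/-- Toeplitz matrix -/
def toep {R : Type} [CommRing R] (a : ℕ → R) (n : ℕ) : Matrix (Fin n) (Fin n) R :=
  Matrix.of fun p q => aZ a (((p : ℕ) : ℤ) - ((q : ℕ) : ℤ))

lemma toep_det {R : Type} [CommRing R] (a : ℕ → R) (ha : a 0 = 1) (n : ℕ) :
    (toep a n).det = 1 := by
  rw [Matrix.det_of_isLowerTriangular]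
  · apply Finset.prod_eq_one
    intro i _
    simp [toep, aZ, ha]
  · intro i j hij
    have : i < j := hij
    rw [toep, Matrix.of_apply, aZ_neg]
    have : (i : ℕ) < (j : ℕ) := this
    omega

lemma toep_mul {R : Type} [CommRing R] (a b : ℕ → R)
    (hab : PowerSeries.mk a * PowerSeries.mk b = 1) (n : ℕ) :
    toep a n * toep b n = 1 := by
  ext p r
  rw [Matrix.mul_apply]
  simp only [toep, Matrix.of_apply]
  rw [Fin.sum_univ_eq_sum_range (fun q => aZ a (((p : ℕ) : ℤ) - (q : ℤ)) *
    aZ b ((q : ℤ) - ((r : ℕ) : ℤ)))]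
  by_cases hpr : (p : ℕ) < (r : ℕ)
  · rw [Matrix.one_apply_ne (by intro h; rw [h] at hpr; omega)]
    apply Finset.sum_eq_zero
    intro q _
    by_cases hq : (p : ℕ) < q
    · rw [aZ_neg a (by omega), zero_mul]
    · rw [aZ_neg b (by omega), mul_zero]
  · have h := congrArg (PowerSeries.coeff ((p : ℕ) - (r : ℕ))) hab
    rw [mul_comm, PowerSeries.coeff_mul, Finset.Nat.sum_antidiagonal_eq_sum_range_succ_mk,
      PowerSeries.coeff_one] at h
    simp only [PowerSeries.coeff_mk] at h
    have h1 : (1 : Matrix (Fin n) (Fin n) R) p r = if (p : ℕ) - (r : ℕ) = 0 then 1 else 0 := by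
      rw [Matrix.one_apply]
      congr 1
      simp only [Fin.ext_iff, eq_iff_iff]
      omega
    rw [h1, ← h]
    symm
    refine Finset.sum_of_injOn (fun k => k + (r : ℕ)) ?_ ?_ ?_ ?_
    · intro x _ y _ hxy
      simpa using hxy
    · intro x hx
      have := p.2
      simp only [Finset.coe_range, Set.mem_Iio] at *
      omega
    · intro q _ hq2
      by_cases hq : (p : ℕ) < q
      · rw [aZ_neg a (by omega), zero_mul]
      · by_cases hq3 : q < (r : ℕ)
        · rw [aZ_neg b (by omega), mul_zero]
        · exfalso
          apply hq2
          refine ⟨q - (r : ℕ), ?_, ?_⟩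
          · simp only [Finset.coe_range, Set.mem_Iio]; omega
          · simp only; omega
    · intro k hk
      rw [Finset.mem_range] at hk
      rw [show ((p : ℕ) : ℤ) - ((k + (r : ℕ) : ℕ) : ℤ) = (((p : ℕ) - (r : ℕ) - k : ℕ) : ℤ) by omega,
        show ((k + (r : ℕ) : ℕ) : ℤ) - ((r : ℕ) : ℤ) = ((k : ℕ) : ℤ) by omega, aZ_nat, aZ_nat,
        mul_comm]

section sigma
variable {f : ℕ → ℕ} (hf : IsPartition f) {n m : ℕ} (hn : ∀ i, n ≤ i → f i = 0) (hm : f 0 ≤ m)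

lemma conj_le (hf : IsPartition f) (hn : ∀ i, n ≤ i → f i = 0) (j : ℕ) : conj f j ≤ n := by
  by_contra hcon
  have := (conj_spec hf n j).2 (by omega)
  rw [hn n le_rfl] at this
  omega

lemma le_m (hf : IsPartition f) (hm : f 0 ≤ m) (i : ℕ) : f i ≤ m :=
  (hf.1 (Nat.zero_le i)).trans hm

/-- the two-block listing of positions attached to a partition -/
def sigFun (hf : IsPartition f) (hn : ∀ i, n ≤ i → f i = 0) (hm : f 0 ≤ m) :
    Fin n ⊕ Fin m → Fin (n + m)
  | Sum.inl i => ⟨f i + (n - 1 - i), by have := le_m hf hm i; have := i.2; omega⟩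
  | Sum.inr j => ⟨n + j - conj f j, by have := j.2; omega⟩

lemma sig_cross (hf : IsPartition f) (hn : ∀ i, n ≤ i → f i = 0) (hm : f 0 ≤ m)
    (i : Fin n) (j : Fin m) :
    ((j : ℕ) < f i → sigFun hf hn hm (Sum.inr j) < sigFun hf hn hm (Sum.inl i)) ∧
    (¬ (j : ℕ) < f i → sigFun hf hn hm (Sum.inl i) < sigFun hf hn hm (Sum.inr j)) := by
  have h1 := conj_spec hf i j
  have h2 := conj_le hf hn j
  have := i.2
  constructor
  · intro h
    have := h1.1 h
    simp only [sigFun, Fin.mk_lt_mk]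
    omega
  · intro h
    have := mt h1.2 h
    simp only [sigFun, Fin.mk_lt_mk]
    omega

lemma sig_inl (hf : IsPartition f) (hn : ∀ i, n ≤ i → f i = 0) (hm : f 0 ≤ m)
    (i i' : Fin n) (h : i < i') : sigFun hf hn hm (Sum.inl i') < sigFun hf hn hm (Sum.inl i) := by
  have h1 : (i : ℕ) < i' := h
  have := hf.1 h1.le
  have := i'.2
  simp only [sigFun, Fin.mk_lt_mk]
  omega

lemma sig_inr (hf : IsPartition f) (hn : ∀ i, n ≤ i → f i = 0) (hm : f 0 ≤ m)
    (i i' : Fin m) (h : i < i') : sigFun hf hn hm (Sum.inr i) < sigFun hf hn hm (Sum.inr i') := by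
  have h1 : (i : ℕ) < i' := h
  have := (conj_isPartition hf).1 h1.le
  have := conj_le hf hn i
  simp only [sigFun, Fin.mk_lt_mk]
  omega

lemma sig_inj (hf : IsPartition f) (hn : ∀ i, n ≤ i → f i = 0) (hm : f 0 ≤ m) :
    Function.Injective (sigFun hf hn hm) := by
  rintro (i | i) (j | j) h
  · rcases lt_trichotomy i j with h1 | h1 | h1
    · exact absurd h (sig_inl hf hn hm _ _ h1).ne'
    · rw [h1]
    · exact absurd h (sig_inl hf hn hm _ _ h1).ne
  · exfalso
    have := sig_cross hf hn hm i j
    by_cases hij : (j : ℕ) < f i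
    · exact (this.1 hij).ne' h
    · exact (this.2 hij).ne h
  · exfalso
    have := sig_cross hf hn hm j i
    by_cases hij : (i : ℕ) < f j
    · exact (this.1 hij).ne h
    · exact (this.2 hij).ne' h
  · rcases lt_trichotomy i j with h1 | h1 | h1
    · exact absurd h (sig_inr hf hn hm _ _ h1).ne
    · rw [h1]
    · exact absurd h (sig_inr hf hn hm _ _ h1).ne'

/-- the listing as an equivalence -/
def sig (hf : IsPartition f) (hn : ∀ i, n ≤ i → f i = 0) (hm : f 0 ≤ m) :
    Fin n ⊕ Fin m ≃ Fin (n + m) :=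
  Equiv.ofBijective (sigFun hf hn hm)
    ((Fintype.bijective_iff_injective_and_card _).2 ⟨sig_inj hf hn hm, by simp⟩)

/-- the listing for the empty partition -/
def sig0 (n m : ℕ) : Fin n ⊕ Fin m ≃ Fin (n + m) :=
  (Equiv.sumCongr Fin.revPerm (Equiv.refl _)).trans finSumFinEquiv

lemma sig0_inl (n m : ℕ) (i : Fin n) : sig0 n m (Sum.inl i) = Fin.castAdd m i.rev := rfl
lemma sig0_inr (n m : ℕ) (i : Fin m) : sig0 n m (Sum.inr i) = Fin.natAdd n i := rfl

lemma sig_sign (hf : IsPartition f) (hn : ∀ i, n ≤ i → f i = 0) (hm : f 0 ≤ m) :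
    ((Equiv.Perm.sign ((sig0 n m).symm.trans (sig hf hn hm)) : ℤˣ) : ℤ) = (-1) ^ psize f := by
  set ρ := (sig0 n m).symm.trans (sig hf hn hm) with hρ
  have r1 : ∀ i : Fin n, ρ (Fin.castAdd m i) = sigFun hf hn hm (Sum.inl i.rev) := by
    intro i
    have : Fin.castAdd m i = sig0 n m (Sum.inl i.rev) := by rw [sig0_inl, Fin.rev_rev]
    rw [hρ, this, Equiv.trans_apply, Equiv.symm_apply_apply]; rfl
  have r2 : ∀ i : Fin m, ρ (Fin.natAdd n i) = sigFun hf hn hm (Sum.inr i) := by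
    intro i
    rw [hρ, ← sig0_inr, Equiv.trans_apply, Equiv.symm_apply_apply]; rfl
  rw [Equiv.Perm.sign_eq_prod_prod_Iio]
  have e : ∀ j : Fin (n + m), (∏ i ∈ Finset.Iio j, if ρ i < ρ j then (1 : ℤˣ) else -1)
      = ∏ i, if i < j then (if ρ i < ρ j then (1 : ℤˣ) else -1) else 1 := by
    intro j
    rw [← Finset.prod_filter]
    congr 1
    ext i; simp
  rw [Finset.prod_congr rfl fun j _ => e j, Fin.prod_univ_add]
  rw [Finset.prod_eq_one, one_mul]
  · have e2 : ∀ j : Fin m, (∏ i, if i < Fin.natAdd n j then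
        (if ρ i < ρ (Fin.natAdd n j) then (1 : ℤˣ) else -1) else 1)
        = ∏ i : Fin n, if (j : ℕ) < f i then (-1 : ℤˣ) else 1 := by
      intro j
      rw [Fin.prod_univ_add, mul_comm, Finset.prod_eq_one, one_mul,
        ← Equiv.prod_comp Fin.revPerm]
      · refine Finset.prod_congr rfl fun i _ => ?_
        rw [if_pos (by
          rw [Fin.lt_def]; simp only [Fin.val_castAdd, Fin.val_natAdd]
          have := (Fin.revPerm i).2; omega), r1, r2, Fin.revPerm_apply, Fin.rev_rev]
        have := sig_cross hf hn hm i j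
        by_cases hij : (j : ℕ) < f i
        · rw [if_pos hij, if_neg (this.1 hij).not_gt]
        · rw [if_neg hij, if_pos (this.2 hij)]
      · intro i _
        by_cases h : i < j
        · rw [if_pos (by simpa using h), r2, r2, if_pos (sig_inr hf hn hm _ _ h)]
        · rw [if_neg (by simpa using h)]
    rw [Finset.prod_congr rfl fun j _ => e2 j, Finset.prod_comm]
    have e3 : ∀ i : Fin n, (∏ j : Fin m, if (j : ℕ) < f i then (-1 : ℤˣ) else 1)
        = (-1) ^ (f i) := by
      intro i
      rw [Fin.prod_univ_eq_prod_range (fun j => if j < f i then (-1 : ℤˣ) else 1),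
        Finset.prod_ite, Finset.prod_const_one, mul_one, Finset.prod_const]
      congr 1
      have : (Finset.range m).filter (fun j => j < f i) = Finset.range (f i) := by
        ext j
        have := le_m hf hm i
        simp only [Finset.mem_filter, Finset.mem_range]
        omega
      rw [this, Finset.card_range]
    rw [Finset.prod_congr rfl fun i _ => e3 i, Finset.prod_pow_eq_pow_sum, psize_eq_sum hn]
    simp
  · intro j _
    rw [Fin.prod_univ_add, Finset.prod_eq_one, one_mul, Finset.prod_eq_one]
    · intro i _
      rw [if_neg]
      rw [Fin.lt_def]; simp only [Fin.val_castAdd, Fin.val_natAdd]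
      have := j.2; omega
    · intro i _
      by_cases h : i < j
      · rw [if_pos (show Fin.castAdd m i < Fin.castAdd m j from h), r1, r1,
          if_pos (sig_inl hf hn hm _ _ (by simpa using h))]
      · rw [if_neg (show ¬ Fin.castAdd m i < Fin.castAdd m j from h)]

end sigma

lemma dual_JT {R : Type} [CommRing R] (a b : ℕ → R) (ha : a 0 = 1)
    (hab : PowerSeries.mk a * PowerSeries.mk b = 1) {f : ℕ → ℕ} (hf : IsPartition f) {n m : ℕ}
    (hn : ∀ i, n ≤ i → f i = 0) (hm : f 0 ≤ m) :
    JT a n f = (-1) ^ psize f * JT b m (conj f) := by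
  have h := compl_minor ((toep a (n + m)).submatrix (sig hf hn hm) (sig0 n m))
    ((toep b (n + m)).submatrix (sig0 n m) (sig hf hn hm)) (by
      rw [Matrix.submatrix_mul_equiv, toep_mul a b hab]
      simp)
  have hdet : ((toep a (n + m)).submatrix (sig hf hn hm) (sig0 n m)).det = (-1) ^ psize f := by
    have : (toep a (n + m)).submatrix (sig hf hn hm) (sig0 n m)
        = ((toep a (n + m)).submatrix ((sig0 n m).symm.trans (sig hf hn hm)) id).submatrix
          (sig0 n m) (sig0 n m) := by
      ext i j
      simp [Matrix.submatrix_apply]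
    rw [this, Matrix.det_submatrix_equiv_self, Matrix.det_permute, toep_det a ha, mul_one,
      sig_sign]
    push_cast
    rfl
  rw [hdet] at h
  have e1 : ((toep a (n + m)).submatrix (sig hf hn hm) (sig0 n m)).toBlocks₁₁.det = JT a n f := by
    unfold JT
    congr 1
    ext1 i j
    simp only [Matrix.toBlocks₁₁, Matrix.of_apply, Matrix.submatrix_apply, toep, sig0_inl]
    congr 1
    have : ((sig hf hn hm (Sum.inl i) : Fin (n + m)) : ℕ) = f i + (n - 1 - i) := rfl
    rw [this]
    simp only [Fin.val_castAdd, Fin.val_rev]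
    have := i.2; have := j.2
    omega
  have e2 : ((toep b (n + m)).submatrix (sig0 n m) (sig hf hn hm)).toBlocks₂₂.det
      = JT b m (conj f) := by
    unfold JT
    rw [← Matrix.det_transpose]
    congr 1
    ext1 i j
    simp only [Matrix.toBlocks₂₂, Matrix.of_apply, Matrix.submatrix_apply, toep, sig0_inr,
      Matrix.transpose_apply]
    congr 1
    have : ((sig hf hn hm (Sum.inr i) : Fin (n + m)) : ℕ) = n + i - conj f i := rfl
    rw [this]
    simp only [Fin.val_natAdd]
    have := conj_le hf hn i
    omega
  rw [e1, e2] at h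
  exact h

/-- signed elementary symmetric polynomials -/
def eb (N k : ℕ) : MvPolynomial (Fin N) ℤ := PowerSeries.coeff k (eSer N Finset.univ)

lemma mk_eb (N : ℕ) : PowerSeries.mk (eb N) = eSer N Finset.univ := by
  ext1 k; rw [PowerSeries.coeff_mk]; rfl

lemma eb_zero (N : ℕ) : eb N 0 = 1 := by
  simp [eb, eSer]

lemma JT_eb {N n : ℕ} {f : ℕ → ℕ} (hf : IsPartition f) (hn : ∀ i, n ≤ i → f i = 0) :
    JT (eb N) n f = (-1) ^ psize f * schur N (conj f) := by
  rw [dual_JT (eb N) (hPoly N) (eb_zero N) (by rw [mk_eb, mul_comm, hPoly_mul_eSer]) hf hn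
    (le_refl (f 0)), schur_eq_JT (conj_isPartition hf)]
  intro j hj
  by_contra hcon
  have := (conj_spec hf 0 j).2 (by omega)
  omega

/-! ### Coefficients of alternants -/

lemma strictMono_gap {N : ℕ} {v : Fin N → ℕ} (hv : StrictMono v) (i j : Fin N) (h : i ≤ j) :
    v i + ((j : ℕ) - i) ≤ v j := by
  obtain ⟨j, hj⟩ := j
  have h' : (i : ℕ) ≤ j := h
  clear h
  induction j, h' using Nat.le_induction with
  | base => simp
  | succ j hij ih =>
    have h1 := ih (by omega)
    have h2 : v ⟨j, by omega⟩ < v ⟨j + 1, hj⟩ := hv (by rw [Fin.lt_def]; simp)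
    simp only at *
    omega

lemma sort_exists {N : ℕ} (g : Fin N → ℕ) (hg : Function.Injective g) :
    ∃ f : ℕ → ℕ, IsPartition f ∧ (∀ i, N ≤ i → f i = 0) ∧
      ∃ σ : Equiv.Perm (Fin N), ∀ k, g k = sh N f (σ k) := by
  set s := Tuple.sort g
  have hv : StrictMono (g ∘ s) :=
    (Tuple.monotone_sort g).strictMono_of_injective (hg.comp s.injective)
  set v := g ∘ s
  have hge : ∀ j : Fin N, (j : ℕ) ≤ v j := by
    intro j
    have := j.2
    have := strictMono_gap hv ⟨0, by omega⟩ j (by rw [Fin.le_def]; simp)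
    simp only at this
    omega
  let f : ℕ → ℕ := fun i => if h : i < N then
    v (Fin.rev ⟨i, h⟩) - (Fin.rev ⟨i, h⟩ : Fin N) else 0
  have hf0 : ∀ i, N ≤ i → f i = 0 := fun i hi => dif_neg (by omega)
  refine ⟨f, ⟨?_, N, hf0⟩, hf0, (Fin.revPerm.trans s).symm, ?_⟩
  · intro i j hij
    by_cases hj : j < N
    · have hi : i < N := by omega
      simp only [f, dif_pos hj, dif_pos hi]
      have := strictMono_gap hv (Fin.rev ⟨j, hj⟩) (Fin.rev ⟨i, hi⟩) (by
        rw [Fin.rev_le_rev]; exact hij)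
      have := hge (Fin.rev ⟨j, hj⟩)
      omega
    · rw [hf0 j (by omega)]; omega
  · intro k
    obtain ⟨l, rfl⟩ := (Fin.revPerm.trans s).surjective k
    rw [Equiv.symm_apply_apply]
    have := hge (Fin.rev l)
    have e : v (Fin.rev l) = g ((Fin.revPerm.trans s) l) := rfl
    rw [← e]
    simp only [sh, f, dif_pos l.2]
    simp only [Fin.eta]
    omega

lemma sh_strictAnti {N : ℕ} {f : ℕ → ℕ} (hf : IsPartition f) : StrictAnti (sh N f) := by
  intro i j hij
  have h : (i : ℕ) < j := hij
  have := hf.1 h.le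
  have := j.2
  simp only [sh, Fin.val_rev]
  omega

lemma sh_unique {N : ℕ} {f g : ℕ → ℕ} (hf : IsPartition f) (hg : IsPartition g)
    (hfN : ∀ i, N ≤ i → f i = 0) (hgN : ∀ i, N ≤ i → g i = 0) (σ τ : Equiv.Perm (Fin N))
    (h : ∀ k, sh N f (σ k) = sh N g (τ k)) : f = g ∧ σ = τ := by
  have hr : Set.range (sh N f) = Set.range (sh N g) := by
    rw [← σ.surjective.range_comp (sh N f), ← τ.surjective.range_comp (sh N g)]
    congr 1
    funext k; exact h k
  have he := ((sh_strictAnti hf).range_inj (sh_strictAnti hg)).1 hr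
  constructor
  · funext i
    by_cases hi : i < N
    · have := congrFun he ⟨i, hi⟩
      simp only [sh] at this
      omega
    · rw [hfN i (by omega), hgN i (by omega)]
  · ext1 k
    have := h k
    rw [he] at this
    exact (sh_strictAnti hg).injective this

lemma coeff_alt {N : ℕ} (g : Fin N → ℕ) (m : Fin N →₀ ℕ) :
    MvPolynomial.coeff m (alt N g) =
      ∑ σ : Equiv.Perm (Fin N), ((Equiv.Perm.sign σ : ℤˣ) : ℤ) *
        if (∀ k, m k = g (σ k)) then 1 else 0 := by
  unfold alt
  rw [Matrix.det_apply', MvPolynomial.coeff_sum]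
  refine Finset.sum_congr rfl fun σ _ => ?_
  have h1 : (∏ i, (Matrix.of fun i k : Fin N => (MvPolynomial.X k : MvPolynomial (Fin N) ℤ) ^ g i)
      (σ i) i) = MvPolynomial.monomial (Finsupp.equivFunOnFinite.symm fun k => g (σ k)) 1 := by
    rw [MvPolynomial.monomial_eq, Finsupp.prod_fintype _ _ (by simp)]
    simp
  rw [h1, ← map_intCast (MvPolynomial.C : ℤ →+* MvPolynomial (Fin N) ℤ),
    MvPolynomial.coeff_C_mul, MvPolynomial.coeff_monomial]
  simp only [Int.cast_id]
  congr 1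
  refine if_congr ?_ rfl rfl
  constructor
  · rintro rfl k; simp
  · intro h; ext k; simp [h]

lemma coeff_alt_sh {N : ℕ} {f g : ℕ → ℕ} (hf : IsPartition f) (hg : IsPartition g)
    (hfN : ∀ i, N ≤ i → f i = 0) (hgN : ∀ i, N ≤ i → g i = 0) (σ : Equiv.Perm (Fin N))
    (m : Fin N →₀ ℕ) (hm : ∀ k, m k = sh N f (σ k)) :
    MvPolynomial.coeff m (alt N (sh N g)) =
      if f = g then ((Equiv.Perm.sign σ : ℤˣ) : ℤ) else 0 := by
  rw [coeff_alt]
  by_cases hfg : f = g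
  · subst hfg
    rw [if_pos rfl, Finset.sum_eq_single σ]
    · rw [if_pos hm, mul_one]
    · intro τ _ hτ
      rw [if_neg, mul_zero]
      intro h
      exact hτ (sh_unique hf hf hfN hfN τ σ fun k => by rw [← h, hm]).2
    · simp
  · rw [if_neg hfg]
    apply Finset.sum_eq_zero
    intro τ _
    rw [if_neg, mul_zero]
    intro h
    exact hfg (sh_unique hf hg hfN hgN σ τ fun k => by rw [← h, hm]).1

lemma coeff_alt_noninj {N : ℕ} {g : ℕ → ℕ} (hg : IsPartition g)
    (m : Fin N →₀ ℕ) (hm : ¬ Function.Injective m) :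
    MvPolynomial.coeff m (alt N (sh N g)) = 0 := by
  rw [coeff_alt]
  apply Finset.sum_eq_zero
  intro τ _
  rw [if_neg, mul_zero]
  intro h
  apply hm
  have : (m : Fin N → ℕ) = sh N g ∘ τ := funext h
  rw [this]
  exact (sh_strictAnti hg).injective.comp τ.injective

/-- the exponent `f + δ` -/
def shF (N : ℕ) (f : ℕ → ℕ) : Fin N →₀ ℕ := Finsupp.equivFunOnFinite.symm (sh N f)

/-- coefficient extraction functional dual to the Schur basis -/
def phi (N : ℕ) (f : ℕ → ℕ) (p : MvPolynomial (Fin N) ℤ) : ℤ :=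
  MvPolynomial.coeff (shF N f) (alt N (sh N 0) * p)

lemma alt0_mul_schur {N : ℕ} {g : ℕ → ℕ} (hg : IsPartition g) (hgN : ∀ i, N ≤ i → g i = 0) :
    alt N (sh N 0) * schur N g = alt N (sh N g) := by
  rw [schur_eq_JT hg hgN, bialternant]

lemma phi_schur {N : ℕ} {f g : ℕ → ℕ} (hf : IsPartition f) (hg : IsPartition g)
    (hfN : ∀ i, N ≤ i → f i = 0) (hgN : ∀ i, N ≤ i → g i = 0) :
    phi N f (schur N g) = if f = g then 1 else 0 := by
  rw [phi, alt0_mul_schur hg hgN,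
    coeff_alt_sh hf hg hfN hgN 1 (shF N f) (fun k => by simp [shF])]
  simp

lemma phi_sum {N : ℕ} (f : ℕ → ℕ) {ι : Type} (s : Finset ι) (p : ι → MvPolynomial (Fin N) ℤ) :
    phi N f (∑ i ∈ s, p i) = ∑ i ∈ s, phi N f (p i) := by
  unfold phi
  rw [Finset.mul_sum, MvPolynomial.coeff_sum]

lemma phi_C {N : ℕ} (f : ℕ → ℕ) (c : ℤ) (p : MvPolynomial (Fin N) ℤ) :
    phi N f ((c : MvPolynomial (Fin N) ℤ) * p) = c * phi N f p := by
  unfold phi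
  rw [mul_left_comm, ← map_intCast (MvPolynomial.C : ℤ →+* MvPolynomial (Fin N) ℤ),
    MvPolynomial.coeff_C_mul]
  simp

lemma alt_homog {N : ℕ} (g : Fin N → ℕ) : (alt N g).IsHomogeneous (∑ i, g i) := by
  intro m hm
  rw [coeff_alt] at hm
  obtain ⟨σ, -, hσ⟩ := Finset.exists_ne_zero_of_sum_ne_zero hm
  have h : ∀ k, m k = g (σ k) := by
    by_contra hcon
    rw [if_neg hcon, mul_zero] at hσ
    exact hσ rfl
  have : Finsupp.weight (1 : Fin N → ℕ) m = ∑ k, m k := by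
    rw [Finsupp.weight_apply, Finsupp.sum_fintype _ _ (by simp)]; simp
  rw [this, Finset.sum_congr rfl fun k _ => h k, Equiv.sum_comp σ g]

lemma sum_sh {N : ℕ} {f : ℕ → ℕ} (hfN : ∀ i, N ≤ i → f i = 0) :
    ∑ i, sh N f i = psize f + ∑ i : Fin N, (i.rev : ℕ) := by
  rw [psize_eq_sum hfN, ← Finset.sum_add_distrib]; rfl

lemma phi_homog {N : ℕ} {f : ℕ → ℕ} (hfN : ∀ i, N ≤ i → f i = 0) {d : ℕ}
    {p : MvPolynomial (Fin N) ℤ} (hp : p.IsHomogeneous d) (hd : psize f ≠ d) :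
    phi N f p = 0 := by
  unfold phi
  apply ((alt_homog (sh N 0)).mul hp).coeff_eq_zero
  have : (shF N f).degree = ∑ i, sh N f i := by
    rw [Finsupp.degree_eq_sum]; simp [shF]
  rw [this, sum_sh hfN]
  have : ∑ i : Fin N, sh N 0 i = ∑ i : Fin N, (i.rev : ℕ) := by simp [sh]
  omega

/-! ### Cauchy identities -/

section cauchy
variable {R : Type} [CommRing R] {N : ℕ}

/-- integer polynomials as power series over `R` -/
def io (R : Type) [CommRing R] (N : ℕ) : MvPolynomial (Fin N) ℤ →+* MvPowerSeries (Fin N) R :=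
  MvPolynomial.coeToMvPowerSeries.ringHom.comp (MvPolynomial.map (Int.castRingHom R))

lemma coeff_io (m : Fin N →₀ ℕ) (p : MvPolynomial (Fin N) ℤ) :
    MvPowerSeries.coeff m (io R N p) = ((MvPolynomial.coeff m p : ℤ) : R) := by
  simp [io, MvPolynomial.coeff_map]

/-- the product `Π_k A(y_k)` -/
def Ahat (N : ℕ) (a : ℕ → R) : MvPowerSeries (Fin N) R := fun m => ∏ k, a (m k)

lemma coeff_Ahat (a : ℕ → R) (m : Fin N →₀ ℕ) :
    MvPowerSeries.coeff m (Ahat N a) = ∏ k, a (m k) := rfl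

lemma Ahat_mul (a b : ℕ → R) (hab : PowerSeries.mk a * PowerSeries.mk b = 1) :
    Ahat N a * Ahat N b = 1 := by
  ext m
  rw [MvPowerSeries.coeff_mul, MvPowerSeries.coeff_one]
  have h : ∀ k : Fin N, ∑ q ∈ Finset.HasAntidiagonal.antidiagonal (m k), a q.1 * b q.2
      = if m k = 0 then 1 else 0 := by
    intro k
    have := congrArg (PowerSeries.coeff (m k)) hab
    rw [PowerSeries.coeff_mul, PowerSeries.coeff_one] at this
    simpa only [PowerSeries.coeff_mk] using this
  have h2 : (if m = 0 then (1 : R) else 0) = ∏ k : Fin N, if m k = 0 then (1 : R) else 0 := by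
    by_cases hm : m = 0
    · rw [if_pos hm, Finset.prod_eq_one]
      intro k _
      rw [hm]; simp
    · rw [if_neg hm]
      obtain ⟨k, hk⟩ := Finsupp.ne_iff.1 hm
      rw [Finset.prod_eq_zero (Finset.mem_univ k)]
      rw [if_neg (by simpa using hk)]
  rw [h2, ← Finset.prod_congr rfl fun k _ => h k, Finset.prod_univ_sum]
  refine Finset.sum_bij (fun p _ k => (p.1 k, p.2 k)) ?_ ?_ ?_ ?_
  · intro p hp
    rw [Finset.HasAntidiagonal.mem_antidiagonal] at hp
    rw [Fintype.mem_piFinset]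
    intro k
    rw [Finset.HasAntidiagonal.mem_antidiagonal, ← hp]; rfl
  · intro p _ q _ hpq
    have : ∀ k, (p.1 k, p.2 k) = (q.1 k, q.2 k) := fun k => congrFun hpq k
    refine Prod.ext (Finsupp.ext fun k => ?_) (Finsupp.ext fun k => ?_)
    · exact congrArg Prod.fst (this k)
    · exact congrArg Prod.snd (this k)
  · intro x hx
    rw [Fintype.mem_piFinset] at hx
    refine ⟨(Finsupp.equivFunOnFinite.symm fun k => (x k).1,
      Finsupp.equivFunOnFinite.symm fun k => (x k).2), ?_, ?_⟩
    · rw [Finset.HasAntidiagonal.mem_antidiagonal]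
      ext k
      have := hx k
      rw [Finset.HasAntidiagonal.mem_antidiagonal] at this
      simpa using this
    · funext k; simp
  · intro p _
    rw [coeff_Ahat, coeff_Ahat, Finset.prod_mul_distrib]

/-- the determinant appearing as coefficient -/
def Dm (a : ℕ → R) (g : Fin N → ℕ) : R :=
  (Matrix.of fun i k : Fin N => aZ a ((g k : ℤ) - ((i.rev : ℕ) : ℤ))).det

lemma Dm_sh (a : ℕ → R) (f : ℕ → ℕ) : Dm a (sh N f) = JT a N f := by
  unfold Dm JT
  rw [← Matrix.det_transpose]
  congr 1
  ext1 i k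
  simp only [Matrix.transpose_apply, Matrix.of_apply, sh, Fin.val_rev]
  congr 1
  have := i.2; have := k.2
  omega

lemma Dm_perm (a : ℕ → R) (g : Fin N → ℕ) (σ : Equiv.Perm (Fin N)) :
    Dm a (fun k => g (σ k)) = ((Equiv.Perm.sign σ : ℤˣ) : ℤ) * Dm a g := by
  unfold Dm
  rw [← Matrix.det_permute' σ]
  rfl

lemma Dm_noninj (a : ℕ → R) (g : Fin N → ℕ) (hg : ¬ Function.Injective g) : Dm a g = 0 := by
  simp only [Function.Injective, not_forall] at hg
  obtain ⟨i, j, h, hij⟩ := hg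
  exact Matrix.det_zero_of_column_eq hij fun k => by simp [h]

lemma alt_eq (g : Fin N → ℕ) : alt N g = ∑ σ : Equiv.Perm (Fin N),
    MvPolynomial.monomial (Finsupp.equivFunOnFinite.symm fun k => g (σ k))
      ((Equiv.Perm.sign σ : ℤˣ) : ℤ) := by
  ext m
  rw [coeff_alt, MvPolynomial.coeff_sum]
  refine Finset.sum_congr rfl fun σ _ => ?_
  rw [MvPolynomial.coeff_monomial, mul_ite, mul_one, mul_zero]
  refine if_congr ?_ rfl rfl
  constructor
  · intro h; ext k; simp [h]
  · rintro rfl k; simp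

lemma io_monomial (m : Fin N →₀ ℕ) (c : ℤ) :
    io R N (MvPolynomial.monomial m c) = MvPowerSeries.monomial m (c : R) := by
  simp [io]

lemma coeff_alt_Ahat (a : ℕ → R) (m : Fin N →₀ ℕ) :
    MvPowerSeries.coeff m (io R N (alt N (sh N 0)) * Ahat N a) = Dm a m := by
  rw [alt_eq, map_sum, Finset.sum_mul, map_sum, Dm, Matrix.det_apply']
  refine Finset.sum_congr rfl fun σ _ => ?_
  rw [io_monomial, MvPowerSeries.coeff_monomial_mul]
  by_cases h : (Finsupp.equivFunOnFinite.symm fun k => sh N 0 (σ k)) ≤ m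
  · rw [if_pos h, coeff_Ahat]
    congr 1
    refine Finset.prod_congr rfl fun k _ => ?_
    have hk := h k
    simp only [Finsupp.equivFunOnFinite_symm_apply_apply, sh, Pi.zero_apply, zero_add] at hk
    rw [Matrix.of_apply, show ((m k : ℕ) : ℤ) - (((σ k).rev : ℕ) : ℤ)
      = ((m k - ((σ k).rev : ℕ) : ℕ) : ℤ) by omega, aZ_nat]
    congr 1
    simp [sh]
  · rw [if_neg h]
    rw [Finsupp.le_def] at h
    push Not at h
    obtain ⟨k, hk⟩ := h
    simp only [Finsupp.equivFunOnFinite_symm_apply_apply, sh, Pi.zero_apply, zero_add] at hk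
    rw [Finset.prod_eq_zero (Finset.mem_univ k), mul_zero]
    rw [Matrix.of_apply, aZ_neg]
    omega

/-- truncated Cauchy kernel -/
def ker (N : ℕ) (a : ℕ → R) (D : ℕ) : MvPowerSeries (Fin N) R :=
  ∑ t ∈ parts D, MvPowerSeries.C (JT a N t.1) * io R N (schur N t.1)

lemma cauchy (a : ℕ → R) {D : ℕ} (hD : D ≤ N) (m : Fin N →₀ ℕ)
    (hm : ∑ k, m k ≤ D + ∑ i : Fin N, (i.rev : ℕ)) :
    MvPowerSeries.coeff m (io R N (alt N (sh N 0)) * ker N a D)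
      = MvPowerSeries.coeff m (io R N (alt N (sh N 0)) * Ahat N a) := by
  rw [coeff_alt_Ahat, ker, Finset.mul_sum, map_sum]
  have hz : ∀ t ∈ parts D, ∀ i, N ≤ i → t.1 i = 0 := by
    intro t ht i hi
    exact eq_zero_of_size_le t.2 ((mem_parts.1 ht).trans hD) i hi
  have h1 : ∀ t ∈ parts D, MvPowerSeries.coeff m (io R N (alt N (sh N 0)) *
      (MvPowerSeries.C (JT a N t.1) * io R N (schur N t.1)))
      = JT a N t.1 * ((MvPolynomial.coeff m (alt N (sh N t.1)) : ℤ) : R) := by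
    intro t ht
    rw [mul_left_comm, MvPowerSeries.coeff_C_mul, ← map_mul, alt0_mul_schur t.2 (hz t ht), coeff_io]
  rw [Finset.sum_congr rfl h1]
  by_cases hinj : Function.Injective m
  · obtain ⟨f, hf, hfN, σ, hσ⟩ := sort_exists m hinj
    have hsz : psize f ≤ D := by
      have := sum_sh hfN
      rw [← Equiv.sum_comp σ] at this
      have h3 : ∑ k, m k = ∑ k, sh N f (σ k) := Finset.sum_congr rfl fun k _ => hσ k
      omega
    rw [Finset.sum_eq_single ⟨f, hf⟩]
    · rw [coeff_alt_sh hf hf hfN hfN σ m hσ, if_pos rfl]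
      have : (m : Fin N → ℕ) = fun k => sh N f (σ k) := funext hσ
      rw [this, Dm_perm, Dm_sh, mul_comm]
    · intro t ht htf
      rw [coeff_alt_sh hf t.2 hfN (hz t ht) σ m hσ, if_neg, Int.cast_zero, mul_zero]
      intro h
      exact htf (Subtype.ext h.symm)
    · intro h
      exact absurd (mem_parts.2 hsz) h
  · rw [Dm_noninj a m hinj]
    apply Finset.sum_eq_zero
    intro t _
    rw [coeff_alt_noninj t.2 m hinj, Int.cast_zero, mul_zero]

/-- agreement up to degree `M` is stable under multiplication -/
lemma trunc_mul {p q : MvPowerSeries (Fin N) R} {M : ℕ}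
    (h : ∀ m : Fin N →₀ ℕ, ∑ k, m k ≤ M → MvPowerSeries.coeff m p = MvPowerSeries.coeff m q)
    (g : MvPowerSeries (Fin N) R) (m : Fin N →₀ ℕ) (hm : ∑ k, m k ≤ M) :
    MvPowerSeries.coeff m (p * g) = MvPowerSeries.coeff m (q * g) := by
  rw [MvPowerSeries.coeff_mul, MvPowerSeries.coeff_mul]
  refine Finset.sum_congr rfl fun x hx => ?_
  rw [Finset.HasAntidiagonal.mem_antidiagonal] at hx
  rw [h x.1]
  refine le_trans (Finset.sum_le_sum fun k _ => ?_) hm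
  rw [← hx]; simp

lemma cauchy_inv (a b : ℕ → R) (hab : PowerSeries.mk a * PowerSeries.mk b = 1)
    {om mu : ℕ → ℕ} (hom : IsPartition om) (hmu : IsPartition mu) (homN : psize om ≤ N)
    (hmuN : psize mu ≤ N) :
    ∑ e ∈ parts (psize om), ∑ t ∈ parts (psize om), JT a N e.1 * JT b N t.1 *
      ((phi N om (schur N e.1 * schur N mu * schur N t.1) : ℤ) : R)
      = if mu = om then 1 else 0 := by
  set D := psize om with hD
  have hz := eq_zero_of_size_le hom homN
  have hz' := eq_zero_of_size_le hmu hmuN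
  set X := io R N (alt N (sh N 0))
  have hm : ∑ k, shF N om k ≤ D + ∑ i : Fin N, (i.rev : ℕ) := by
    rw [hD, ← sum_sh hz]; simp [shF]
  have s1 := trunc_mul (fun m hm => cauchy a homN m hm) (ker N b D * io R N (schur N mu)) (shF N om) hm
  have s2 := trunc_mul (fun m hm => cauchy b homN m hm) (Ahat N a * io R N (schur N mu)) (shF N om) hm
  have e1 : X * Ahat N a * (ker N b D * io R N (schur N mu))
      = X * ker N b D * (Ahat N a * io R N (schur N mu)) := by ring
  have e2 : X * Ahat N b * (Ahat N a * io R N (schur N mu)) = X * io R N (schur N mu) := by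
    linear_combination X * io R N (schur N mu) * Ahat_mul (N := N) a b hab
  rw [e1, s2, e2] at s1
  have e3 : MvPowerSeries.coeff (shF N om) (X * io R N (schur N mu)) = if mu = om then 1 else 0 := by
    rw [← map_mul, coeff_io]
    have := phi_schur hom hmu hz hz'
    rw [phi] at this
    rw [this]
    simp only [eq_comm]
    split_ifs <;> simp
  rw [← e3, ← s1]
  have e4 : X * ker N a D * (ker N b D * io R N (schur N mu)) =
      ∑ e ∈ parts D, ∑ t ∈ parts D, MvPowerSeries.C (JT a N e.1 * JT b N t.1) *
        io R N (alt N (sh N 0) * (schur N e.1 * schur N mu * schur N t.1)) := by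
    rw [ker, ker, Finset.mul_sum, Finset.sum_mul]
    refine Finset.sum_congr rfl fun e _ => ?_
    rw [Finset.sum_mul, Finset.mul_sum]
    refine Finset.sum_congr rfl fun t _ => ?_
    simp only [map_mul]
    ring
  rw [e4, map_sum]
  refine Finset.sum_congr rfl fun e _ => ?_
  rw [map_sum]
  refine Finset.sum_congr rfl fun t _ => ?_
  rw [MvPowerSeries.coeff_C_mul, coeff_io]
  rfl

end cauchy

/-! ### Assembly -/

lemma finsum_parts {D : ℕ} {F : Partition → ℤ} (h : ∀ p, F p ≠ 0 → psize p.1 ≤ D) :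
    ∑ᶠ p : Partition, F p = ∑ p ∈ parts D, F p := by
  apply finsum_eq_sum_of_support_subset
  intro p hp
  exact Finset.mem_coe.2 (mem_parts.2 (h p hp))

section lr
variable {N : ℕ} {c : (ℕ → ℕ) → (ℕ → ℕ) → (ℕ → ℕ) → ℤ}

lemma schur_mul (hc : ∀ al be : ℕ → ℕ, IsPartition al → IsPartition be →
      schur N al * schur N be =
        ∑ᶠ ga : Partition,
          if psize ga.1 = psize al + psize be then
            (c ga.1 al be : MvPolynomial (Fin N) ℤ) * schur N ga.1
          else 0) {al be : ℕ → ℕ} (hal : IsPartition al) (hbe : IsPartition be)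
    (hs : psize al + psize be ≤ N) :
    schur N al * schur N be = ∑ ga ∈ parts N, if psize ga.1 = psize al + psize be then
      (c ga.1 al be : MvPolynomial (Fin N) ℤ) * schur N ga.1 else 0 := by
  rw [hc al be hal hbe]
  apply finsum_eq_sum_of_support_subset
  intro p hp
  refine Finset.mem_coe.2 (mem_parts.2 ?_)
  by_contra hcon
  apply hp
  simp only
  rw [if_neg]; omega

lemma phi_double (hc : ∀ al be : ℕ → ℕ, IsPartition al → IsPartition be →
      schur N al * schur N be =
        ∑ᶠ ga : Partition,
          if psize ga.1 = psize al + psize be then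
            (c ga.1 al be : MvPolynomial (Fin N) ℤ) * schur N ga.1
          else 0) {lam al be : ℕ → ℕ} (hlam : IsPartition lam) (hal : IsPartition al)
    (hbe : IsPartition be) (hl : psize lam = psize al + psize be) (hs : psize lam ≤ N) :
    phi N lam (schur N al * schur N be) = c lam al be := by
  rw [schur_mul hc hal hbe (by omega), phi_sum, Finset.sum_eq_single ⟨lam, hlam⟩]
  · rw [if_pos hl, phi_C, phi_schur hlam hlam (eq_zero_of_size_le hlam hs)
      (eq_zero_of_size_le hlam hs), if_pos rfl, mul_one]
  · intro ga hga hne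
    by_cases h : psize ga.1 = psize al + psize be
    · rw [if_pos h, phi_C, phi_schur hlam ga.2 (eq_zero_of_size_le hlam hs)
        (eq_zero_of_size_le ga.2 (mem_parts.1 hga)), if_neg, mul_zero]
      intro h2
      exact hne (Subtype.ext h2.symm)
    · rw [if_neg h]; simp [phi]
  · intro h
    exact absurd (mem_parts.2 hs) h

lemma phi_triple (hc : ∀ al be : ℕ → ℕ, IsPartition al → IsPartition be →
      schur N al * schur N be =
        ∑ᶠ ga : Partition,
          if psize ga.1 = psize al + psize be then
            (c ga.1 al be : MvPolynomial (Fin N) ℤ) * schur N ga.1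
          else 0) {lam al be et : ℕ → ℕ} (hlam : IsPartition lam) (hal : IsPartition al)
    (hbe : IsPartition be) (het : IsPartition et)
    (hl : psize lam = psize al + psize be + psize et) (hs : psize lam ≤ N) :
    phi N lam (schur N al * schur N be * schur N et) = ∑ ga ∈ parts N,
      if psize ga.1 = psize al + psize be then c ga.1 al be * c lam ga.1 et else 0 := by
  rw [schur_mul hc hal hbe (by omega), Finset.sum_mul, phi_sum]
  refine Finset.sum_congr rfl fun ga _ => ?_
  by_cases h : psize ga.1 = psize al + psize be
  · rw [if_pos h, if_pos h, mul_assoc, phi_C, phi_double hc hlam ga.2 het (by omega) hs]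
  · rw [if_neg h, if_neg h]; simp [phi]

end lr

/-- **Littlewood–Richardson four-fold identity** (Proposition 3.8).
For any partitions `λ, μ, ν, ω` and any family of integers `c^λ_{μν}` satisfying the
Littlewood–Richardson expansion equations `s_μ s_ν = Σ_{γ : |γ| = |μ|+|ν|} c^γ_{μν} s_γ`
in `N` variables with `N ≥ |λ| + |μ| + |ν| + |ω|`:
`Σ_{γ,η,σ,τ} (−1)^{|τ|} c^γ_{τ'ν} c^λ_{γη} c^σ_{ημ} c^ω_{στ} = δ_{λν} δ_{μω}`,
where the sum runs over quadruples of partitions subject to the degree constraints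
`|γ| = |τ| + |ν|`, `|λ| = |γ| + |η|`, `|σ| = |η| + |μ|`, `|ω| = |σ| + |τ|`
(only finitely many terms are nonzero). -/
theorem lr_fourfold_identity
    (N : ℕ) (lam mu nu om : ℕ → ℕ)
    (hlam : IsPartition lam) (hmu : IsPartition mu)
    (hnu : IsPartition nu) (hom : IsPartition om)
    (hN : psize lam + psize mu + psize nu + psize om ≤ N)
    (c : (ℕ → ℕ) → (ℕ → ℕ) → (ℕ → ℕ) → ℤ)
    (hc : ∀ al be : ℕ → ℕ, IsPartition al → IsPartition be →
      schur N al * schur N be =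
        ∑ᶠ ga : Partition,
          if psize ga.1 = psize al + psize be then
            (c ga.1 al be : MvPolynomial (Fin N) ℤ) * schur N ga.1
          else 0) :
    (∑ᶠ (ga : Partition) (eta : Partition) (si : Partition) (ta : Partition),
        if psize ga.1 = psize ta.1 + psize nu ∧ psize lam = psize ga.1 + psize eta.1 ∧
            psize si.1 = psize eta.1 + psize mu ∧ psize om = psize si.1 + psize ta.1 then
          (-1 : ℤ) ^ psize ta.1 * c ga.1 (conj ta.1) nu * c lam ga.1 eta.1 *
            c si.1 eta.1 mu * c om si.1 ta.1
        else 0) =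
      if lam = nu ∧ mu = om then 1 else 0 := by
  have homN : psize om ≤ N := by omega
  -- reduce to finite sums
  rw [finsum_parts (D := N) (by
    intro ga hga
    by_contra hcon
    apply hga
    refine finsum_eq_zero_of_forall_eq_zero fun eta => ?_
    refine finsum_eq_zero_of_forall_eq_zero fun si => ?_
    refine finsum_eq_zero_of_forall_eq_zero fun ta => ?_
    rw [if_neg]; omega)]
  have r1 : ∀ ga ∈ parts N, (∑ᶠ (eta : Partition) (si : Partition) (ta : Partition),
        if psize ga.1 = psize ta.1 + psize nu ∧ psize lam = psize ga.1 + psize eta.1 ∧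
            psize si.1 = psize eta.1 + psize mu ∧ psize om = psize si.1 + psize ta.1 then
          (-1 : ℤ) ^ psize ta.1 * c ga.1 (conj ta.1) nu * c lam ga.1 eta.1 *
            c si.1 eta.1 mu * c om si.1 ta.1
        else 0) = ∑ eta ∈ parts (psize om), ∑ ta ∈ parts (psize om), ∑ si ∈ parts N,
        if psize ga.1 = psize ta.1 + psize nu ∧ psize lam = psize ga.1 + psize eta.1 ∧
            psize si.1 = psize eta.1 + psize mu ∧ psize om = psize si.1 + psize ta.1 then
          (-1 : ℤ) ^ psize ta.1 * c ga.1 (conj ta.1) nu * c lam ga.1 eta.1 *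
            c si.1 eta.1 mu * c om si.1 ta.1
        else 0 := by
    intro ga _
    rw [finsum_parts (D := psize om) (by
      intro eta heta
      by_contra hcon
      apply heta
      refine finsum_eq_zero_of_forall_eq_zero fun si => ?_
      refine finsum_eq_zero_of_forall_eq_zero fun ta => ?_
      rw [if_neg]; omega)]
    refine Finset.sum_congr rfl fun eta _ => ?_
    rw [finsum_parts (D := N) (by
      intro si hsi
      by_contra hcon
      apply hsi
      refine finsum_eq_zero_of_forall_eq_zero fun ta => ?_
      rw [if_neg]; omega)]
    rw [Finset.sum_comm]
    refine Finset.sum_congr rfl fun si _ => ?_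
    rw [finsum_parts (D := psize om) (by
      intro ta hta
      by_contra hcon
      apply hta
      rw [if_neg]; omega)]
  rw [Finset.sum_congr rfl r1, Finset.sum_comm]
  -- evaluate the inner sums
  have r2 : ∀ eta ∈ parts (psize om), (∑ ga ∈ parts N, ∑ ta ∈ parts (psize om), ∑ si ∈ parts N,
        if psize ga.1 = psize ta.1 + psize nu ∧ psize lam = psize ga.1 + psize eta.1 ∧
            psize si.1 = psize eta.1 + psize mu ∧ psize om = psize si.1 + psize ta.1 then
          (-1 : ℤ) ^ psize ta.1 * c ga.1 (conj ta.1) nu * c lam ga.1 eta.1 *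
            c si.1 eta.1 mu * c om si.1 ta.1
        else 0) = ∑ ta ∈ parts (psize om), (-1 : ℤ) ^ psize ta.1 *
          phi N lam (schur N (conj ta.1) * schur N nu * schur N eta.1) *
          phi N om (schur N eta.1 * schur N mu * schur N ta.1) := by
    intro eta _
    rw [Finset.sum_comm]
    refine Finset.sum_congr rfl fun ta _ => ?_
    have hct := conj_isPartition ta.2
    have hcs := psize_conj ta.2
    by_cases h1 : psize lam = psize ta.1 + psize nu + psize eta.1
    · by_cases h2 : psize om = psize eta.1 + psize mu + psize ta.1
      · rw [phi_triple hc hlam hct hnu eta.2 (by omega) (by omega),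
          phi_triple hc hom eta.2 hmu ta.2 (by omega) (by omega), mul_assoc,
          Finset.sum_mul_sum, Finset.mul_sum]
        refine Finset.sum_congr rfl fun ga _ => ?_
        rw [Finset.mul_sum]
        refine Finset.sum_congr rfl fun si _ => ?_
        by_cases h3 : psize ga.1 = psize ta.1 + psize nu
        · by_cases h4 : psize si.1 = psize eta.1 + psize mu
          · rw [if_pos (by omega), if_pos (by omega), if_pos h4]; ring
          · rw [if_neg (by omega), if_neg h4]; ring
        · rw [if_neg (by omega), if_neg (by omega)]; ring
      · rw [phi_homog (f := om) (eq_zero_of_size_le hom homN)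
          (((schur_homog eta.2).mul (schur_homog hmu)).mul (schur_homog ta.2)) h2, mul_zero]
        refine Finset.sum_eq_zero fun ga _ => Finset.sum_eq_zero fun si _ => ?_
        rw [if_neg]; omega
    · rw [phi_homog (f := lam) (eq_zero_of_size_le hlam (by omega))
          (((schur_homog hct).mul (schur_homog hnu)).mul (schur_homog eta.2)) (by omega), mul_zero,
          zero_mul]
      refine Finset.sum_eq_zero fun ga _ => Finset.sum_eq_zero fun si _ => ?_
      rw [if_neg]; omega
  rw [Finset.sum_congr rfl r2]
  -- use the Cauchy identities
  have key := cauchy_inv (N := N) (hPoly N) (eb N) (by rw [mk_eb, hPoly_mul_eSer]) hom hmu homN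
    (by omega)
  have key2 := congrArg (fun p => phi N lam (schur N nu * p)) key
  simp only [Finset.mul_sum, phi_sum] at key2
  have r3 : ∀ eta ∈ parts (psize om), ∀ ta ∈ parts (psize om),
      phi N lam (schur N nu * (JT (hPoly N) N eta.1 * JT (eb N) N ta.1 *
        ((phi N om (schur N eta.1 * schur N mu * schur N ta.1) : ℤ) : MvPolynomial (Fin N) ℤ)))
      = (-1 : ℤ) ^ psize ta.1 *
          phi N lam (schur N (conj ta.1) * schur N nu * schur N eta.1) *
          phi N om (schur N eta.1 * schur N mu * schur N ta.1) := by
    intro eta heta ta hta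
    rw [JT_eb ta.2 (eq_zero_of_size_le ta.2 ((mem_parts.1 hta).trans homN)),
      ← schur_eq_JT eta.2 (eq_zero_of_size_le eta.2 ((mem_parts.1 heta).trans homN))]
    generalize phi N om (schur N eta.1 * schur N mu * schur N ta.1) = z
    rw [show schur N nu * (schur N eta.1 * ((-1) ^ psize ta.1 * schur N (conj ta.1)) *
        (z : MvPolynomial (Fin N) ℤ)) = (((-1) ^ psize ta.1 * z : ℤ) : MvPolynomial (Fin N) ℤ) *
        (schur N (conj ta.1) * schur N nu * schur N eta.1) by push_cast; ring, phi_C]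
    ring
  rw [Finset.sum_congr rfl fun eta heta => Finset.sum_congr rfl fun ta hta => r3 eta heta ta hta]
    at key2
  rw [key2]
  have hl := phi_schur (N := N) hlam hnu (eq_zero_of_size_le hlam (by omega))
    (eq_zero_of_size_le hnu (by omega))
  by_cases h1 : mu = om
  · rw [if_pos h1, mul_one, hl]
    simp [h1]
  · rw [if_neg h1, mul_zero, if_neg (by tauto)]
    simp [phi]


end DoubleMacdonald
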